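/- arXiv:0807.2929 — 3 statements merged into one kernel-verified Lean document; each statement's English description precedes it below -/
import Mathlib

section
/- Let δ > 0 and let b0, b1, b2, b3 : {v : 0 < |v| < δ} → ℝ be functions such that for every v in the domain: N(v, b0(v), b1(v), b2(v), b3(v)) = 0, (∂N/∂v)(v, b0(v), b1(v), b2(v), b3(v)) = 0, b0(v) = -95/6 + 16·b3(v) + 6·b2(v), and b1(v) = 125/12 - 9·b3(v) - 4·b2(v). Then (b3(v) - 17671/12096)/v^2 → -45767/362880 as v → 0 with v ≠ 0; that is, the second-order Taylor coefficient at v = 0 of the b3-coefficient of the method with zero phase-lag and zero first derivative of the phase-lag equals -45767/362880. -/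
/-- Phase-lag numerator of the symmetric 8-step method. -/
noncomputable def N (v b0 b1 b2 b3 : ℝ) : ℝ :=
  16 * Real.cos v ^ 4 + (8 * b3 * v ^ 2 - 16) * Real.cos v ^ 3
    + (4 * b2 * v ^ 2 - 8) * Real.cos v ^ 2
    + (10 + (2 * b1 - 6 * b3) * v ^ 2) * Real.cos v - 2
    + (b0 - 2 * b2) * v ^ 2

open Filter Topology

/-- `f v = a₀ + a₁ v² + a₂ v⁴ + a₃ v⁶ + a₄ v⁸ + o(v⁸)` as `v → 0`, `v ≠ 0`. -/
def HasEvenExpansion (f : ℝ → ℝ) (a₀ a₁ a₂ a₃ a₄ : ℝ) : Prop :=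
  Tendsto (fun v => (f v - (a₀ + a₁ * v ^ 2 + a₂ * v ^ 4 + a₃ * v ^ 6)) / v ^ 8)
    (𝓝[≠] 0) (𝓝 a₄)

namespace HasEvenExpansion

variable {f g : ℝ → ℝ} {a₀ a₁ a₂ a₃ a₄ b₀ b₁ b₂ b₃ b₄ : ℝ}

theorem of_eq {h : ℝ → ℝ} (hh : Tendsto h (𝓝[≠] 0) (𝓝 a₄))
    (hf : ∀ v, v ≠ 0 → f v = a₀ + a₁ * v ^ 2 + a₂ * v ^ 4 + a₃ * v ^ 6 + v ^ 8 * h v) :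
    HasEvenExpansion f a₀ a₁ a₂ a₃ a₄ := by
  refine hh.congr' ?_
  filter_upwards [self_mem_nhdsWithin] with v hv
  have hv : v ≠ 0 := hv
  rw [hf v hv]
  field_simp
  ring

theorem exists_remainder (hf : HasEvenExpansion f a₀ a₁ a₂ a₃ a₄) :
    ∃ h : ℝ → ℝ, Tendsto h (𝓝[≠] 0) (𝓝 a₄) ∧
      ∀ v, v ≠ 0 → f v = a₀ + a₁ * v ^ 2 + a₂ * v ^ 4 + a₃ * v ^ 6 + v ^ 8 * h v := by
  refine ⟨_, hf, fun v hv => ?_⟩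
  field_simp
  ring

theorem const (c : ℝ) : HasEvenExpansion (fun _ => c) c 0 0 0 0 :=
  of_eq (h := fun _ => 0) tendsto_const_nhds fun v _ => by ring

theorem sq : HasEvenExpansion (fun v => v ^ 2) 0 1 0 0 0 :=
  of_eq (h := fun _ => 0) tendsto_const_nhds fun v _ => by ring

theorem add (hf : HasEvenExpansion f a₀ a₁ a₂ a₃ a₄) (hg : HasEvenExpansion g b₀ b₁ b₂ b₃ b₄) :
    HasEvenExpansion (fun v => f v + g v)
      (a₀ + b₀) (a₁ + b₁) (a₂ + b₂) (a₃ + b₃) (a₄ + b₄) := by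
  obtain ⟨h, hh, hf⟩ := hf.exists_remainder
  obtain ⟨k, hk, hg⟩ := hg.exists_remainder
  refine of_eq (hh.add hk) fun v hv => ?_
  rw [hf v hv, hg v hv]
  ring

theorem mul (hf : HasEvenExpansion f a₀ a₁ a₂ a₃ a₄) (hg : HasEvenExpansion g b₀ b₁ b₂ b₃ b₄) :
    HasEvenExpansion (fun v => f v * g v)
      (a₀ * b₀) (a₀ * b₁ + a₁ * b₀) (a₀ * b₂ + a₁ * b₁ + a₂ * b₀)
      (a₀ * b₃ + a₁ * b₂ + a₂ * b₁ + a₃ * b₀)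
      (a₀ * b₄ + a₁ * b₃ + a₂ * b₂ + a₃ * b₁ + a₄ * b₀) := by
  obtain ⟨h, hh, hf⟩ := hf.exists_remainder
  obtain ⟨k, hk, hg⟩ := hg.exists_remainder
  have hv : Tendsto (fun v : ℝ => v) (𝓝[≠] 0) (𝓝 0) := nhdsWithin_le_nhds
  let G : ℝ × ℝ × ℝ → ℝ := fun p =>
    a₀ * p.2.2 + a₁ * b₃ + a₂ * b₂ + a₃ * b₁ + p.2.1 * b₀
      + p.1 ^ 2 * (a₁ * p.2.2 + a₂ * b₃ + a₃ * b₂ + p.2.1 * b₁)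
      + p.1 ^ 4 * (a₂ * p.2.2 + a₃ * b₃ + p.2.1 * b₂)
      + p.1 ^ 6 * (a₃ * p.2.2 + p.2.1 * b₃) + p.1 ^ 8 * (p.2.1 * p.2.2)
  have hG : Continuous G := by fun_prop
  have hG0 : G (0, a₄, b₄) = a₀ * b₄ + a₁ * b₃ + a₂ * b₂ + a₃ * b₁ + a₄ * b₀ := by simp [G]
  have hlim := (hG.tendsto (0, a₄, b₄)).comp (hv.prodMk_nhds (hh.prodMk_nhds hk))
  rw [hG0] at hlim
  refine of_eq hlim fun v hv => ?_
  rw [hf v hv, hg v hv]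
  simp only [G, Function.comp_apply]
  ring

theorem tendsto (hf : HasEvenExpansion f a₀ a₁ a₂ a₃ a₄) : Tendsto f (𝓝[≠] 0) (𝓝 a₀) := by
  obtain ⟨h, hh, hf⟩ := hf.exists_remainder
  have hv : Tendsto (fun v : ℝ => v) (𝓝[≠] 0) (𝓝 0) := nhdsWithin_le_nhds
  have hlim : Tendsto (fun v => a₀ + a₁ * v ^ 2 + a₂ * v ^ 4 + a₃ * v ^ 6 + v ^ 8 * h v)
      (𝓝[≠] 0) (𝓝 (a₀ + a₁ * 0 ^ 2 + a₂ * 0 ^ 4 + a₃ * 0 ^ 6 + 0 ^ 8 * a₄)) :=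
    ((((tendsto_const_nhds.add ((hv.pow 2).const_mul a₁)).add ((hv.pow 4).const_mul a₂)).add
      ((hv.pow 6).const_mul a₃)).add ((hv.pow 8).mul hh))
  have hlim' : Tendsto (fun v => a₀ + a₁ * v ^ 2 + a₂ * v ^ 4 + a₃ * v ^ 6 + v ^ 8 * h v)
      (𝓝[≠] 0) (𝓝 a₀) := by simpa using hlim
  refine hlim'.congr' ?_
  filter_upwards [self_mem_nhdsWithin] with v hv
  exact (hf v hv).symm

end HasEvenExpansion

/-- The Taylor polynomials of `cos` and `sin` of degree at most `10` approximate them up to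
`O(v ^ 11)`. -/
theorem exists_cos_sin_taylor_bound : ∃ K : ℝ, ∀ v : ℝ, |v| ≤ 1 →
    |Real.cos v - (1 - v ^ 2 / 2 + v ^ 4 / 24 - v ^ 6 / 720 + v ^ 8 / 40320 - v ^ 10 / 3628800)|
        ≤ K * |v| ^ 11 ∧
    |Real.sin v - (v - v ^ 3 / 6 + v ^ 5 / 120 - v ^ 7 / 5040 + v ^ 9 / 362880)|
        ≤ K * |v| ^ 11 := by
  refine ⟨((Nat.succ 11 : ℕ) : ℝ) * (((Nat.factorial 11 : ℕ) : ℝ) * ((11 : ℕ) : ℝ))⁻¹,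
    fun v hv => ?_⟩
  have hnorm : ‖(v : ℂ) * Complex.I‖ = |v| := by simp
  have hb := Complex.exp_bound (x := v * Complex.I) (by rwa [hnorm]) (n := 11) (by norm_num)
  rw [hnorm, mul_comm (|v| ^ 11)] at hb
  have key : Complex.exp (v * Complex.I)
      - ∑ m ∈ Finset.range 11, ((v : ℂ) * Complex.I) ^ m / m.factorial
      = ((Real.cos v - (1 - v ^ 2 / 2 + v ^ 4 / 24 - v ^ 6 / 720 + v ^ 8 / 40320
          - v ^ 10 / 3628800) : ℝ) : ℂ)
        + ((Real.sin v - (v - v ^ 3 / 6 + v ^ 5 / 120 - v ^ 7 / 5040 + v ^ 9 / 362880) : ℝ) : ℂ)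
          * Complex.I := by
    rw [Complex.exp_mul_I]
    simp only [Finset.sum_range_succ, Finset.sum_range_zero, mul_pow, Nat.factorial]
    push_cast
    norm_num [Complex.I_sq, Complex.I_pow_three]
    ring
  rw [key] at hb
  refine ⟨le_trans ?_ hb, le_trans ?_ hb⟩
  · refine le_trans (le_of_eq ?_) (Complex.abs_re_le_norm _)
    simp only [Complex.add_re, Complex.ofReal_re, Complex.re_ofReal_mul, Complex.I_re, mul_zero,
      add_zero]
  · refine le_trans (le_of_eq ?_) (Complex.abs_im_le_norm _)
    simp only [Complex.add_im, Complex.ofReal_im, Complex.im_ofReal_mul, Complex.I_im, mul_one,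
      zero_add]

/-- A function that is `O(v ^ 11)` is `o(v ^ n)` for `n ≤ 10`. -/
theorem tendsto_div_pow_of_abs_le {r : ℝ → ℝ} {K : ℝ} {n : ℕ} (hn : n ≤ 10)
    (hr : ∀ v : ℝ, |v| ≤ 1 → |r v| ≤ K * |v| ^ 11) :
    Tendsto (fun v => r v / v ^ n) (𝓝[≠] 0) (𝓝 0) := by
  have hv : Tendsto (fun v : ℝ => v) (𝓝[≠] 0) (𝓝 0) := nhdsWithin_le_nhds
  have hlim : Tendsto (fun v : ℝ => K * |v| ^ (11 - n)) (𝓝[≠] 0) (𝓝 0) := by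
    have h := (hv.abs.pow (11 - n)).const_mul K
    rwa [abs_zero, zero_pow (by omega), mul_zero] at h
  refine squeeze_zero_norm' ?_ hlim
  have hsmall : ∀ᶠ v : ℝ in 𝓝[≠] 0, |v| < 1 := hv.abs.eventually_lt_const (by simp)
  filter_upwards [hsmall, self_mem_nhdsWithin] with v h1 h0
  have hpos : 0 < |v| := abs_pos.mpr h0
  rw [Real.norm_eq_abs, abs_div, abs_pow, div_le_iff₀ (by positivity), mul_assoc, ← pow_add,
    show 11 - n + n = 11 by omega]
  exact hr v h1.le

theorem hasEvenExpansion_cos_sub_one_div_sq :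
    HasEvenExpansion (fun v => (Real.cos v - 1) / v ^ 2)
      (-1 / 2) (1 / 24) (-1 / 720) (1 / 40320) (-1 / 3628800) := by
  obtain ⟨K, hK⟩ := exists_cos_sin_taylor_bound
  have h := (tendsto_div_pow_of_abs_le (n := 10) le_rfl fun v hv => (hK v hv).1).const_add
    (-1 / 3628800)
  rw [add_zero] at h
  refine .of_eq h fun v hv => ?_
  field_simp
  ring

theorem hasEvenExpansion_sin_div :
    HasEvenExpansion (fun v => Real.sin v / v)
      1 (-1 / 6) (1 / 120) (-1 / 5040) (1 / 362880) := by
  obtain ⟨K, hK⟩ := exists_cos_sin_taylor_bound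
  have h := (tendsto_div_pow_of_abs_le (n := 9) (by norm_num) fun v hv => (hK v hv).2).const_add
    (1 / 362880)
  rw [add_zero] at h
  refine .of_eq h fun v hv => ?_
  field_simp
  ring

theorem hasDerivAt_N (v b0 b1 b2 b3 : ℝ) :
    HasDerivAt (fun w => N w b0 b1 b2 b3)
      (-Real.sin v * (64 * Real.cos v ^ 3 + 3 * (8 * b3 * v ^ 2 - 16) * Real.cos v ^ 2
          + 2 * (4 * b2 * v ^ 2 - 8) * Real.cos v + (10 + (2 * b1 - 6 * b3) * v ^ 2))
        + 2 * v * (8 * b3 * Real.cos v ^ 3 + 4 * b2 * Real.cos v ^ 2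
          + (2 * b1 - 6 * b3) * Real.cos v + (b0 - 2 * b2))) v := by
  have hc := Real.hasDerivAt_cos v
  have hs := hasDerivAt_pow 2 v
  have h := ((((((hc.pow 4).const_mul 16).add
    (((hs.const_mul (8 * b3)).sub_const 16).mul (hc.pow 3))).add
    (((hs.const_mul (4 * b2)).sub_const 8).mul (hc.pow 2))).add
    (((hs.const_mul (2 * b1 - 6 * b3)).const_add 10).mul hc)).sub_const 2).add
    (hs.const_mul (b0 - 2 * b2))
  refine h.congr_deriv ?_
  simp only [Pi.pow_apply]
  norm_num
  ring

/-- Eliminating `b0`, `b1`, `b2` from the four defining equations of the method, in terms of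
`d = (cos v - 1) / v ^ 2` and `σ = sin v / v`. -/
theorem b3_mul_eq {v b0 b1 b2 b3 d σ : ℝ} (hv : v ≠ 0)
    (hd : Real.cos v = 1 + v ^ 2 * d) (hσ : Real.sin v = v * σ)
    (hN : N v b0 b1 b2 b3 = 0) (hN' : deriv (fun w => N w b0 b1 b2 b3) v = 0)
    (h0 : b0 = -95 / 6 + 16 * b3 + 6 * b2) (h1 : b1 = 125 / 12 - 9 * b3 - 4 * b2) :
    b3 * (v ^ 2 * v ^ 2 * v ^ 2 * (8 * (d * d * d * σ))) =
      σ * (10 + d * (10 + v ^ 2 * (125 / 6) + v ^ 2 * v ^ 2 * (d * d) * (-48 + v ^ 2 * d * -32)))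
        + -2 * (d * d) * (10 + v ^ 2 * d * (40 + v ^ 2 * d * (48 + v ^ 2 * d * 16))) := by
  rw [(hasDerivAt_N v b0 b1 b2 b3).deriv] at hN'
  unfold N at hN
  rw [hd, hσ, h0, h1] at hN'
  rw [hd, h0, h1] at hN
  refine mul_left_cancel₀ (pow_ne_zero 4 hv) ?_
  linear_combination (2 * (v ^ 2 * d - v ^ 2 * σ)) * hN - v * (v ^ 2 * d) * hN'

/-- The second-order Taylor coefficient at `v = 0` of the `b3` coefficient of
the method with zero phase-lag and zero first derivative of the phase-lag is
`-45767/362880`. -/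
theorem b3_zero_PL_PL'_second_taylor_coeff
    (δ : ℝ) (hδ : 0 < δ) (b0 b1 b2 b3 : ℝ → ℝ)
    (hcond : ∀ v : ℝ, 0 < |v| → |v| < δ →
      N v (b0 v) (b1 v) (b2 v) (b3 v) = 0 ∧
      deriv (fun w => N w (b0 v) (b1 v) (b2 v) (b3 v)) v = 0 ∧
      b0 v = -95 / 6 + 16 * b3 v + 6 * b2 v ∧
      b1 v = 125 / 12 - 9 * b3 v - 4 * b2 v) :
    Filter.Tendsto (fun v : ℝ => (b3 v - 17671 / 12096) / v ^ 2)
      (nhdsWithin 0 {(0 : ℝ)}ᶜ) (nhds (-45767 / 362880)) := by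
  set d : ℝ → ℝ := fun v => (Real.cos v - 1) / v ^ 2 with hd_def
  set σ : ℝ → ℝ := fun v => Real.sin v / v with hσ_def
  have hd : HasEvenExpansion d _ _ _ _ _ := hasEvenExpansion_cos_sub_one_div_sq
  have hσ : HasEvenExpansion σ _ _ _ _ _ := hasEvenExpansion_sin_div
  have ht := HasEvenExpansion.sq
  have hc := HasEvenExpansion.const
  have hden := (hc 8).mul (((hd.mul hd).mul hd).mul hσ)
  have htd := ht.mul hd
  have hnum := ((hσ.mul ((hc 10).add (hd.mul (((hc 10).add (ht.mul (hc (125 / 6)))).add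
      (((ht.mul ht).mul (hd.mul hd)).mul ((hc (-48)).add (htd.mul (hc (-32))))))))).add
    (((hc (-2)).mul (hd.mul hd)).mul ((hc 10).add (htd.mul ((hc 40).add
      (htd.mul ((hc 48).add (htd.mul (hc 16))))))))).add
    ((hc (-17671 / 12096)).mul (((ht.mul ht).mul ht).mul hden))
  have hden_lim := hden.tendsto
  norm_num only at hden_lim
  have hden_ne := hden_lim.eventually_ne (show (-1 : ℝ) ≠ 0 by norm_num)
  unfold HasEvenExpansion at hnum
  norm_num only at hnum
  have hlim := hnum.div hden_lim (by norm_num)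
  have hδ' : ∀ᶠ v : ℝ in 𝓝[≠] 0, |v| < δ := by
    have hv : Tendsto (fun v : ℝ => v) (𝓝[≠] 0) (𝓝 0) := nhdsWithin_le_nhds
    exact hv.abs.eventually_lt_const (by simpa using hδ)
  norm_num only at hlim ⊢
  refine hlim.congr' ?_
  filter_upwards [hδ', hden_ne, self_mem_nhdsWithin] with v hvδ hne hv0
  have hv : v ≠ 0 := hv0
  obtain ⟨hN, hN', h0, h1⟩ := hcond v (abs_pos.mpr hv) hvδ
  have key := b3_mul_eq (d := d v) (σ := σ v) hv (by simp only [hd_def]; field_simp; ring)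
    (by simp only [hσ_def]; field_simp) hN hN' h0 h1
  simp only [Pi.div_apply]
  rw [div_div, div_eq_div_iff (mul_ne_zero (pow_ne_zero 8 hv) hne) (pow_ne_zero 2 hv)]
  linear_combination (-v ^ 2) * key
end

section
/- Let ω > 0, let y : ℝ → ℝ be infinitely differentiable, and let x ∈ ℝ. Let b3(v) = (1/96)·C(v)/D(v) with C(v) = -192·cos(v)^4 + 192·cos(v)^3 + (96 - 327·v^2)·cos(v)^2 + (-120 + 404·v^2)·cos(v) - 137·v^2 + 24 and D(v) = v^2·(cos(v) - 1)^3, and b2(v) = -6·b3(v) + 109/16, b1(v) = 15·b3(v) - 101/6, b0(v) = -20·b3(v) + 601/24. Define, for h ≠ 0 with cos(ωh) ≠ 1, L_h = y(x+4h) + y(x-4h) - 2(y(x+3h)+y(x-3h)) + 2(y(x+2h)+y(x-2h)) - (y(x+h)+y(x-h)) - h^2·[ b3(ωh)(y''(x+3h)+y''(x-3h)) + b2(ωh)(y''(x+2h)+y''(x-2h)) + b1(ωh)(y''(x+h)+y''(x-h)) + b0(ωh)·y''(x) ]. Then L_h / h^10 → (45767/725760)·( y^{(10)}(x) + ω^2·y^{(8)}(x)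 ) as h → 0 with h ≠ 0; i.e., the principal term of the local truncation error of the phase-fitted method is (45767/725760)·h^10·( y^{(10)} + ω^2·y^{(8)} ). -/
/-- Numerator of the phase-fitted `b3` coefficient. -/
noncomputable def C (v : ℝ) : ℝ :=
  -192 * Real.cos v ^ 4 + 192 * Real.cos v ^ 3
    + (96 - 327 * v ^ 2) * Real.cos v ^ 2
    + (-120 + 404 * v ^ 2) * Real.cos v - 137 * v ^ 2 + 24

/-- Denominator of the phase-fitted `b3` coefficient. -/
noncomputable def D (v : ℝ) : ℝ := v ^ 2 * (Real.cos v - 1) ^ 3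

/-- Variable coefficients of the phase-fitted 8-step method. -/
noncomputable def b3PF (v : ℝ) : ℝ := (1 / 96) * C v / D v

noncomputable def b2PF (v : ℝ) : ℝ := -6 * b3PF v + 109 / 16

noncomputable def b1PF (v : ℝ) : ℝ := 15 * b3PF v - 101 / 6

noncomputable def b0PF (v : ℝ) : ℝ := -20 * b3PF v + 601 / 24

open Filter Topology

/-- The symmetric form of Taylor's theorem with Peano remainder. -/
theorem tendsto_symmetric_taylor_remainder {f : ℝ → ℝ} {n : ℕ} (hf : ContDiff ℝ n f) (x c : ℝ) :
    Tendsto (fun h : ℝ => (f (x + c * h) + f (x - c * h)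
        - ∑ i ∈ Finset.range (n + 1),
            iteratedDeriv i f x / (i.factorial : ℝ) * ((c * h) ^ i + (-(c * h)) ^ i)) / h ^ n)
      (𝓝[≠] 0) (𝓝 0) := by
  have one_sided (d : ℝ) : (fun h : ℝ => f (x + d * h) - ∑ i ∈ Finset.range (n + 1),
      iteratedDeriv i f x / (i.factorial : ℝ) * (d * h) ^ i) =o[𝓝 0] fun h => h ^ n := by
    have hd : Tendsto (fun h : ℝ => x + d * h) (𝓝 0) (𝓝 x) :=
      Continuous.tendsto' (by fun_prop) _ _ (by simp)
    have ho := (taylor_isLittleO_univ (x₀ := x) hf).comp_tendsto hd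
    have hO : (fun h : ℝ => (x + d * h - x) ^ n) =O[𝓝 0] fun h : ℝ => h ^ n := by
      simpa [mul_pow] using Asymptotics.isBigO_const_mul_self (d ^ n) (fun h : ℝ => h ^ n) (𝓝 0)
    refine (ho.trans_isBigO hO).congr_left fun h => ?_
    simp only [Function.comp_apply, taylor_within_apply, iteratedDerivWithin_univ, smul_eq_mul,
      add_sub_cancel_left]
    congr 1
    exact Finset.sum_congr rfl fun i _ => by ring
  have hsum := ((one_sided c).add (one_sided (-c))).tendsto_div_nhds_zero
  refine (hsum.mono_left nhdsWithin_le_nhds).congr fun h => ?_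
  simp only [mul_add, Finset.sum_add_distrib, neg_mul, ← sub_eq_add_neg]
  ring

/-- The scaled remainder of the eighth-order Taylor expansion of the cosine. -/
noncomputable def cosRemainder (v : ℝ) : ℝ :=
  (Real.cos v - (1 - v ^ 2 / 2 + v ^ 4 / 24 - v ^ 6 / 720 + v ^ 8 / 40320)) / v ^ 10

theorem tendsto_cosRemainder : Tendsto cosRemainder (𝓝[≠] 0) (𝓝 (-1 / 3628800)) := by
  have h := tendsto_symmetric_taylor_remainder (n := 10) Real.contDiff_cos 0 1
  have e (i : ℕ) : iteratedDeriv (2 * i) Real.cos 0 = (-1) ^ i := by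
    simp [Real.iteratedDeriv_even_cos]
  have e2 : iteratedDeriv 2 Real.cos 0 = -1 := (e 1).trans (by norm_num)
  have e4 : iteratedDeriv 4 Real.cos 0 = 1 := (e 2).trans (by norm_num)
  have e6 : iteratedDeriv 6 Real.cos 0 = -1 := (e 3).trans (by norm_num)
  have e8 : iteratedDeriv 8 Real.cos 0 = 1 := (e 4).trans (by norm_num)
  have e10 : iteratedDeriv 10 Real.cos 0 = -1 := (e 5).trans (by norm_num)
  have h' := (h.div_const 2).add_const (-1 / 3628800)
  rw [zero_div, zero_add] at h'
  refine h'.congr' ?_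
  filter_upwards [self_mem_nhdsWithin] with v hv
  have hv : v ≠ 0 := hv
  simp only [Finset.sum_range_succ, Finset.sum_range_zero, Nat.reduceAdd, e2, e4, e6, e8, e10,
    iteratedDeriv_zero, Real.cos_zero, Nat.factorial, zero_add, zero_sub, one_mul, Real.cos_neg,
    cosRemainder]
  push_cast
  field_simp
  ring

/-- `b3PF` agrees with its classical limit `17671 / 12096` up to a quadratic correction. -/
theorem exists_b3PF_expansion : ∃ e : ℝ → ℝ,
    Tendsto e (𝓝[≠] 0) (𝓝 (-(45767 / 725760))) ∧
      ∀ᶠ v in 𝓝[≠] (0 : ℝ), b3PF v = 17671 / 12096 + v ^ 2 * e v := by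
  have hu : Tendsto (fun v : ℝ => v ^ 2) (𝓝[≠] 0) (𝓝 0) :=
    (Continuous.tendsto' (by fun_prop) _ _ (by simp)).mono_left nhdsWithin_le_nhds
  have hk := tendsto_cosRemainder
  set k := cosRemainder with hkdef
  obtain ⟨q3, hq3⟩ : ∃ q : ℝ → ℝ, q = fun v => 1 / 40320 + v ^ 2 * k v := ⟨_, rfl⟩
  obtain ⟨q2, hq2⟩ : ∃ q : ℝ → ℝ, q = fun v => -1 / 720 + v ^ 2 * q3 v := ⟨_, rfl⟩
  obtain ⟨q1, hq1⟩ : ∃ q : ℝ → ℝ, q = fun v => 1 / 24 + v ^ 2 * q2 v := ⟨_, rfl⟩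
  obtain ⟨q0, hq0⟩ : ∃ q : ℝ → ℝ, q = fun v => -1 / 2 + v ^ 2 * q1 v := ⟨_, rfl⟩
  have t3 : Tendsto q3 (𝓝[≠] 0) (𝓝 (1 / 40320)) := by
    simpa only [hq3, zero_mul, add_zero] using (hu.mul hk).const_add (1 / 40320)
  have t2 : Tendsto q2 (𝓝[≠] 0) (𝓝 (-1 / 720)) := by
    simpa only [hq2, zero_mul, add_zero] using (hu.mul t3).const_add (-1 / 720)
  have t1 : Tendsto q1 (𝓝[≠] 0) (𝓝 (1 / 24)) := by
    simpa only [hq1, zero_mul, add_zero] using (hu.mul t2).const_add (1 / 24)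
  have t0 : Tendsto q0 (𝓝[≠] 0) (𝓝 (-1 / 2)) := by
    simpa only [hq0, zero_mul, add_zero] using (hu.mul t1).const_add (-1 / 2)
  obtain ⟨F, hF⟩ : ∃ F : ℝ × ℝ × ℝ × ℝ × ℝ → ℝ, F = fun p =>
      -120 * p.2.2.2.2 + 230 * p.2.2.2.1 - 145 * p.2.2.1 - 480 * p.1 * p.2.2.1 ^ 2
        + 537 * p.2.1 ^ 2 - 576 * p.1 * p.2.1 ^ 3
        - 192 * (-1 / 2 * p.2.1 + 3 / 2 * p.1 * p.2.1 ^ 2 - 2 * p.1 ^ 2 * p.2.1 ^ 3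
          + p.1 ^ 3 * p.2.1 ^ 4)
        - 17671 / 126 * (3 / 4 * p.2.1 - 3 / 2 * p.1 * p.2.1 ^ 2 + p.1 ^ 2 * p.2.1 ^ 3) :=
    ⟨_, rfl⟩
  have hFc : Continuous F := by rw [hF]; fun_prop
  have hnum := (hFc.tendsto _).comp
    (hu.prodMk_nhds (t1.prodMk_nhds (t2.prodMk_nhds (t3.prodMk_nhds hk))))
  refine ⟨fun v => F (v ^ 2, q1 v, q2 v, q3 v, k v) / (96 * q0 v ^ 3), ?_, ?_⟩
  · have hlim : F (0, 1 / 24, -1 / 720, 1 / 40320, -1 / 3628800) / (96 * (-1 / 2) ^ 3) =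
        -(45767 / 725760) := by
      rw [hF]
      norm_num
    rw [← hlim]
    exact hnum.div ((t0.pow 3).const_mul 96) (by norm_num)
  · filter_upwards [t0.eventually_ne (by norm_num : (-1 / 2 : ℝ) ≠ 0), self_mem_nhdsWithin]
      with v hv0 hv
    have hv : v ≠ 0 := hv
    have hk' : v ^ 10 * k v =
        Real.cos v - (1 - v ^ 2 / 2 + v ^ 4 / 24 - v ^ 6 / 720 + v ^ 8 / 40320) := by
      rw [hkdef, cosRemainder]
      field_simp
    have e3 : q3 v = 1 / 40320 + v ^ 2 * k v := by rw [hq3]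
    have e2 : q2 v = -1 / 720 + v ^ 2 * q3 v := by rw [hq2]
    have e1 : q1 v = 1 / 24 + v ^ 2 * q2 v := by rw [hq1]
    have e0 : q0 v = -1 / 2 + v ^ 2 * q1 v := by rw [hq0]
    have hcos : Real.cos v = 1 + v ^ 2 * q0 v := by
      rw [e0, e1, e2, e3]
      linear_combination -hk'
    have hD : D v = v ^ 8 * q0 v ^ 3 := by
      rw [D, hcos]
      ring
    have hC : C v = v ^ 8 * (17671 / 126 * q0 v ^ 3 + v ^ 2 * F (v ^ 2, q1 v, q2 v, q3 v, k v)) := by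
      rw [C, hcos, hF]
      simp only [e0, e1, e2, e3]
      ring
    rw [b3PF, hC, hD]
    field_simp
    ring

/-- The principal term of the local truncation error of the phase-fitted
8-step method is `(45767/725760) · h^10 · (y⁽¹⁰⁾ + ω² y⁽⁸⁾)`. -/
theorem phase_fitted_method_principal_LTE
    (ω : ℝ) (hω : 0 < ω) (y : ℝ → ℝ) (hy : ContDiff ℝ (⊤ : ℕ∞) y) (x : ℝ) :
    Filter.Tendsto
      (fun h : ℝ =>
        (y (x + 4 * h) + y (x - 4 * h)
          - 2 * (y (x + 3 * h) + y (x - 3 * h))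
          + 2 * (y (x + 2 * h) + y (x - 2 * h))
          - (y (x + h) + y (x - h))
          - h ^ 2 *
            (b3PF (ω * h) * (iteratedDeriv 2 y (x + 3 * h) + iteratedDeriv 2 y (x - 3 * h))
              + b2PF (ω * h) * (iteratedDeriv 2 y (x + 2 * h) + iteratedDeriv 2 y (x - 2 * h))
              + b1PF (ω * h) * (iteratedDeriv 2 y (x + h) + iteratedDeriv 2 y (x - h))
              + b0PF (ω * h) * iteratedDeriv 2 y x)) / h ^ 10)
      (nhdsWithin 0 {(0 : ℝ)}ᶜ)
      (nhds ((45767 / 725760) * (iteratedDeriv 10 y x + ω ^ 2 * iteratedDeriv 8 y x))) := by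
  have hy10 : ContDiff ℝ (10 : ℕ) y := contDiff_infty.1 hy 10
  have hy8 : ContDiff ℝ (8 : ℕ) (iteratedDeriv 2 y) := by
    rw [iteratedDeriv_eq_iterate]
    exact ContDiff.iterate_deriv' 8 2 hy10
  have hshift (i : ℕ) : iteratedDeriv i (iteratedDeriv 2 y) x = iteratedDeriv (i + 2) y x := by
    simp only [iteratedDeriv_eq_iterate, Function.iterate_add_apply]
  have hρ (c : ℝ) : ∃ ρ : ℝ → ℝ, Tendsto ρ (𝓝[≠] 0) (𝓝 0) ∧ ∀ h ≠ 0,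
      y (x + c * h) + y (x - c * h) = 2 * (y x + iteratedDeriv 2 y x * (c * h) ^ 2 / 2
        + iteratedDeriv 4 y x * (c * h) ^ 4 / 24 + iteratedDeriv 6 y x * (c * h) ^ 6 / 720
        + iteratedDeriv 8 y x * (c * h) ^ 8 / 40320
        + iteratedDeriv 10 y x * (c * h) ^ 10 / 3628800) + h ^ 10 * ρ h := by
    refine ⟨_, tendsto_symmetric_taylor_remainder hy10 x c, fun h hh => ?_⟩
    rw [mul_div_cancel₀ _ (pow_ne_zero 10 hh)]
    simp only [Finset.sum_range_succ, Finset.sum_range_zero, Nat.factorial, iteratedDeriv_zero]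
    push_cast
    ring
  have hσ (c : ℝ) : ∃ σ : ℝ → ℝ, Tendsto σ (𝓝[≠] 0) (𝓝 0) ∧ ∀ h ≠ 0,
      iteratedDeriv 2 y (x + c * h) + iteratedDeriv 2 y (x - c * h) =
        2 * (iteratedDeriv 2 y x + iteratedDeriv 4 y x * (c * h) ^ 2 / 2
        + iteratedDeriv 6 y x * (c * h) ^ 4 / 24 + iteratedDeriv 8 y x * (c * h) ^ 6 / 720
        + iteratedDeriv 10 y x * (c * h) ^ 8 / 40320) + h ^ 8 * σ h := by
    refine ⟨_, tendsto_symmetric_taylor_remainder hy8 x c, fun h hh => ?_⟩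
    rw [mul_div_cancel₀ _ (pow_ne_zero 8 hh)]
    simp only [Finset.sum_range_succ, Finset.sum_range_zero, Nat.factorial, hshift]
    push_cast
    ring
  obtain ⟨ρ4, tρ4, hρ4⟩ := hρ 4
  obtain ⟨ρ3, tρ3, hρ3⟩ := hρ 3
  obtain ⟨ρ2, tρ2, hρ2⟩ := hρ 2
  obtain ⟨ρ1, tρ1, hρ1⟩ := hρ 1
  obtain ⟨σ3, tσ3, hσ3⟩ := hσ 3
  obtain ⟨σ2, tσ2, hσ2⟩ := hσ 2
  obtain ⟨σ1, tσ1, hσ1⟩ := hσ 1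
  obtain ⟨e, te, he⟩ := exists_b3PF_expansion
  have hid : Tendsto (fun h : ℝ => h) (𝓝[≠] 0) (𝓝 0) := tendsto_id.mono_left nhdsWithin_le_nhds
  have hscale : Tendsto (fun h : ℝ => ω * h) (𝓝[≠] 0) (𝓝[≠] 0) := by
    refine tendsto_nhdsWithin_iff.2 ⟨by simpa using hid.const_mul ω, ?_⟩
    filter_upwards [self_mem_nhdsWithin] with h hh
    exact mul_ne_zero hω.ne' hh
  have te' := te.comp hscale
  have tB : Tendsto (fun h : ℝ => 17671 / 12096 + (ω * h) ^ 2 * e (ω * h)) (𝓝[≠] 0)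
      (𝓝 (17671 / 12096)) := by
    simpa using (((hid.const_mul ω).pow 2).mul te').const_add (17671 / 12096)
  have key := (((((tρ4.sub (tρ3.const_mul 2)).add (tρ2.const_mul 2)).sub tρ1).sub
    (((tB.mul tσ3).add (((tB.const_mul (-6)).add_const (109 / 16)).mul tσ2)).add
      (((tB.const_mul 15).sub_const (101 / 6)).mul tσ1))).add_const
        (45767 / 725760 * iteratedDeriv 10 y x)).sub
    ((te'.const_mul (ω ^ 2)).mul
      (((hid.pow 2).mul_const (iteratedDeriv 10 y x / 4)).const_add (iteratedDeriv 8 y x)))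
  refine (key.congr' ?_).trans_eq ?_
  · filter_upwards [hscale.eventually he, self_mem_nhdsWithin] with h hB hh
    have hh : h ≠ 0 := hh
    rw [eq_div_iff (pow_ne_zero 10 hh), b2PF, b1PF, b0PF, hB]
    have hρ1' := hρ1 h hh
    have hσ1' := hσ1 h hh
    rw [one_mul] at hρ1' hσ1'
    rw [hρ4 h hh, hρ3 h hh, hρ2 h hh, hρ1', hσ3 h hh, hσ2 h hh, hσ1']
    simp only [Function.comp_apply]
    ring
  · congr 1
    ring
end

section
/- Let ω > 0, let y : ℝ → ℝ be infinitely differentiable, and let x ∈ ℝ. Let δ > 0 and let b0, b1, b2, b3 : {v : 0 < |v| < δ} → ℝ satisfy, for every v in the domain: N(v, b0(v), b1(v), b2(v), b3(v)) = 0, (∂N/∂v)(v, b0(v), b1(v), b2(v), b3(v)) = 0, b0(v) = -95/6 + 16·b3(v) + 6·b2(v), and b1(v) = 125/12 - 9·b3(v) - 4·b2(v). Define, for 0 < |h| < δ/ω, L_h = y(x+4h) + y(x-4h) - 2(y(x+3h)+y(x-3h)) + 2(y(x+2h)+y(x-2h)) - (y(x+h)+y(x-h)) - h^2·[ b3(ωh)(y''(x+3h)+y''(x-3h))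 + b2(ωh)(y''(x+2h)+y''(x-2h)) + b1(ωh)(y''(x+h)+y''(x-h)) + b0(ωh)·y''(x) ]. Then L_h / h^10 → (45767/725760)·( y^{(10)}(x) + 2·ω^2·y^{(8)}(x) + ω^4·y^{(6)}(x) ) as h → 0 with h ≠ 0. -/
open Filter Topology Finset

theorem ContDiff.exists_taylor_remainder {f : ℝ → ℝ} {n : ℕ} (hf : ContDiff ℝ n f) (a : ℝ) :
    ∃ r : ℝ → ℝ, Tendsto r (𝓝[≠] 0) (𝓝 0) ∧ ∀ t ≠ 0,
      f (a + t) = ∑ k ∈ range (n + 1), (k.factorial : ℝ)⁻¹ * t ^ k * iteratedDeriv k f a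
        + t ^ n * r t := by
  have htaylor := Real.taylor_tendsto (x₀ := a) convex_univ (Set.mem_univ a) hf.contDiffOn
  rw [nhdsWithin_univ] at htaylor
  have hshift : Tendsto (fun t : ℝ => a + t) (𝓝[≠] 0) (𝓝 a) := by
    have : Tendsto (fun t : ℝ => a + t) (𝓝 0) (𝓝 (a + 0)) :=
      (continuous_const.add continuous_id).tendsto 0
    rw [add_zero] at this
    exact this.mono_left nhdsWithin_le_nhds
  refine ⟨_, htaylor.comp hshift, fun t ht => ?_⟩
  simp only [Function.comp_apply, add_sub_cancel_left, taylor_within_apply,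
    iteratedDerivWithin_univ, smul_eq_mul]
  field_simp
  ring

theorem tendsto_const_mul_punctured_nhds_zero {c : ℝ} (hc : c ≠ 0) :
    Tendsto (fun t : ℝ => c * t) (𝓝[≠] 0) (𝓝[≠] 0) := by
  refine tendsto_nhdsWithin_iff.2 ⟨?_, ?_⟩
  · have : Tendsto (fun t : ℝ => c * t) (𝓝 0) (𝓝 (c * 0)) :=
      (continuous_const.mul continuous_id).tendsto 0
    rw [mul_zero] at this
    exact this.mono_left nhdsWithin_le_nhds
  · filter_upwards [self_mem_nhdsWithin] with t ht
    exact mul_ne_zero hc ht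

theorem ContDiff.exists_symmetric_taylor_ten {f : ℝ → ℝ} (hf : ContDiff ℝ 10 f) (a : ℝ) :
    ∃ r : ℝ → ℝ, Tendsto r (𝓝[≠] 0) (𝓝 0) ∧ ∀ t ≠ 0,
      f (a + t) + f (a - t) = 2 * f a + iteratedDeriv 2 f a * t ^ 2
        + iteratedDeriv 4 f a * t ^ 4 / 12 + iteratedDeriv 6 f a * t ^ 6 / 360
        + iteratedDeriv 8 f a * t ^ 8 / 20160 + iteratedDeriv 10 f a * t ^ 10 / 1814400
        + t ^ 10 * r t := by
  obtain ⟨r, hr, hfr⟩ := ContDiff.exists_taylor_remainder (n := 10) hf a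
  refine ⟨fun t => r t + r (-1 * t), ?_, fun t ht => ?_⟩
  · simpa using hr.add (hr.comp (tendsto_const_mul_punctured_nhds_zero (c := -1) (by norm_num)))
  · have h₁ := hfr t ht
    have h₂ := hfr (-1 * t) (mul_ne_zero (by norm_num) ht)
    rw [show a + -1 * t = a - t by ring] at h₂
    rw [h₁, h₂]
    simp only [sum_range_succ, range_zero, sum_empty, Nat.factorial, iteratedDeriv_zero]
    push_cast
    ring

theorem ContDiff.exists_symmetric_taylor_eight {f : ℝ → ℝ} (hf : ContDiff ℝ 8 f) (a : ℝ) :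
    ∃ r : ℝ → ℝ, Tendsto r (𝓝[≠] 0) (𝓝 0) ∧ ∀ t ≠ 0,
      f (a + t) + f (a - t) = 2 * f a + iteratedDeriv 2 f a * t ^ 2
        + iteratedDeriv 4 f a * t ^ 4 / 12 + iteratedDeriv 6 f a * t ^ 6 / 360
        + iteratedDeriv 8 f a * t ^ 8 / 20160 + t ^ 8 * r t := by
  obtain ⟨r, hr, hfr⟩ := ContDiff.exists_taylor_remainder (n := 8) hf a
  refine ⟨fun t => r t + r (-1 * t), ?_, fun t ht => ?_⟩
  · simpa using hr.add (hr.comp (tendsto_const_mul_punctured_nhds_zero (c := -1) (by norm_num)))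
  · have h₁ := hfr t ht
    have h₂ := hfr (-1 * t) (mul_ne_zero (by norm_num) ht)
    rw [show a + -1 * t = a - t by ring] at h₂
    rw [h₁, h₂]
    simp only [sum_range_succ, range_zero, sum_empty, Nat.factorial, iteratedDeriv_zero]
    push_cast
    ring

theorem exists_cos_taylor_ten : ∃ r : ℝ → ℝ, Tendsto r (𝓝[≠] 0) (𝓝 0) ∧ ∀ t ≠ 0,
    Real.cos t = 1 - t ^ 2 / 2 + t ^ 4 / 24 - t ^ 6 / 720 + t ^ 8 / 40320 - t ^ 10 / 3628800
      + t ^ 10 * r t := by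
  obtain ⟨r, hr, h⟩ := ContDiff.exists_taylor_remainder (n := 10) Real.contDiff_cos 0
  refine ⟨r, hr, fun t ht => ?_⟩
  have := h t ht
  simp [sum_range_succ, Nat.factorial] at this
  rw [this]
  ring

theorem exists_cos_taylor_eight : ∃ r : ℝ → ℝ, Tendsto r (𝓝[≠] 0) (𝓝 0) ∧ ∀ t ≠ 0,
    Real.cos t = 1 - t ^ 2 / 2 + t ^ 4 / 24 - t ^ 6 / 720 + t ^ 8 / 40320
      + t ^ 8 * r t := by
  obtain ⟨r, hr, h⟩ := ContDiff.exists_taylor_remainder (n := 8) Real.contDiff_cos 0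
  refine ⟨r, hr, fun t ht => ?_⟩
  have := h t ht
  simp [sum_range_succ, Nat.factorial] at this
  rw [this]
  ring

theorem exists_sin_taylor_nine : ∃ r : ℝ → ℝ, Tendsto r (𝓝[≠] 0) (𝓝 0) ∧ ∀ t ≠ 0,
    Real.sin t = t - t ^ 3 / 6 + t ^ 5 / 120 - t ^ 7 / 5040 + t ^ 9 / 362880
      + t ^ 9 * r t := by
  obtain ⟨r, hr, h⟩ := ContDiff.exists_taylor_remainder (n := 9) Real.contDiff_sin 0
  refine ⟨r, hr, fun t ht => ?_⟩
  have := h t ht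
  simp [sum_range_succ, Nat.factorial] at this
  rw [this]
  ring

theorem exists_sin_taylor_seven : ∃ r : ℝ → ℝ, Tendsto r (𝓝[≠] 0) (𝓝 0) ∧ ∀ t ≠ 0,
    Real.sin t = t - t ^ 3 / 6 + t ^ 5 / 120 - t ^ 7 / 5040 + t ^ 7 * r t := by
  obtain ⟨r, hr, h⟩ := ContDiff.exists_taylor_remainder (n := 7) Real.contDiff_sin 0
  refine ⟨r, hr, fun t ht => ?_⟩
  have := h t ht
  simp [sum_range_succ, Nat.factorial] at this
  rw [this]
  ring

theorem tendsto_of_perturbed_linear_system {α : Type*} {l : Filter α}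
    {X Y a₀ a₁ a₂ c₀ c₁ c₂ : α → ℝ} {A C : ℝ}
    (ha₀ : Tendsto a₀ l (𝓝 0)) (ha₁ : Tendsto a₁ l (𝓝 0)) (ha₂ : Tendsto a₂ l (𝓝 0))
    (hc₀ : Tendsto c₀ l (𝓝 0)) (hc₁ : Tendsto c₁ l (𝓝 0)) (hc₂ : Tendsto c₂ l (𝓝 0))
    (hX : ∀ᶠ v in l, X v = A + a₀ v + a₁ v * X v + a₂ v * Y v)
    (hY : ∀ᶠ v in l, Y v = C + c₀ v + c₁ v * X v + c₂ v * Y v) :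
    Tendsto X l (𝓝 A) ∧ Tendsto Y l (𝓝 C) := by
  have hdet : Tendsto (fun v => (1 - a₁ v) * (1 - c₂ v) - a₂ v * c₁ v) l (𝓝 1) := by
    simpa using ((ha₁.const_sub 1).mul (hc₂.const_sub 1)).sub (ha₂.mul hc₁)
  have hne := hdet.eventually_ne one_ne_zero
  constructor
  · have hlim := (((ha₀.const_add A).mul (hc₂.const_sub 1)).add
      (ha₂.mul (hc₀.const_add C))).div hdet one_ne_zero
    simp only [add_zero, sub_zero, mul_one, zero_mul, div_one] at hlim
    refine hlim.congr' ?_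
    filter_upwards [hX, hY, hne] with v h₁ h₂ h₃
    simp only [Pi.div_apply]
    rw [div_eq_iff h₃]
    linear_combination (-(1 - c₂ v)) * h₁ - a₂ v * h₂
  · have hlim := (((hc₀.const_add C).mul (ha₁.const_sub 1)).add
      (hc₁.mul (ha₀.const_add A))).div hdet one_ne_zero
    simp only [add_zero, sub_zero, mul_one, zero_mul, div_one] at hlim
    refine hlim.congr' ?_
    filter_upwards [hX, hY, hne] with v h₁ h₂ h₃
    simp only [Pi.div_apply]
    rw [div_eq_iff h₃]
    linear_combination (-(1 - a₁ v)) * h₂ - c₁ v * h₁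

theorem N_eq_cos_multiples (v b0 b1 b2 b3 : ℝ) :
    N v b0 b1 b2 b3 = 2 * Real.cos (4 * v) - 4 * Real.cos (3 * v) + 4 * Real.cos (2 * v)
      - 2 * Real.cos v + v ^ 2 * (2 * b3 * Real.cos (3 * v) + 2 * b2 * Real.cos (2 * v)
      + 2 * b1 * Real.cos v + b0) := by
  rw [show (4 : ℝ) * v = 2 * (2 * v) by ring, Real.cos_two_mul (2 * v), Real.cos_three_mul,
    Real.cos_two_mul, N]
  ring

theorem deriv_N (v b0 b1 b2 b3 : ℝ) :
    deriv (fun w => N w b0 b1 b2 b3) v = -8 * Real.sin (4 * v) + 12 * Real.sin (3 * v)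
      - 8 * Real.sin (2 * v) + 2 * Real.sin v
      + 2 * v * (2 * b3 * Real.cos (3 * v) + 2 * b2 * Real.cos (2 * v)
        + 2 * b1 * Real.cos v + b0)
      - v ^ 2 * (6 * b3 * Real.sin (3 * v) + 4 * b2 * Real.sin (2 * v)
        + 2 * b1 * Real.sin v) := by
  simp_rw [N_eq_cos_multiples]
  have hcos (c : ℝ) : HasDerivAt (fun w => Real.cos (c * w)) (-Real.sin (c * v) * (c * 1)) v :=
    ((hasDerivAt_id v).const_mul c).cos
  have hcos₁ := Real.hasDerivAt_cos v
  have h := ((((hcos 4).const_mul 2).sub ((hcos 3).const_mul 4)).add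
    ((hcos 2).const_mul 4)).sub (hcos₁.const_mul 2) |>.add
    ((hasDerivAt_pow 2 v).mul (((((hcos 3).const_mul (2 * b3)).add
      ((hcos 2).const_mul (2 * b2))).add (hcos₁.const_mul (2 * b1))).add_const b0))
  refine h.deriv.trans ?_
  simp only [Pi.add_apply, Nat.cast_ofNat]
  ring

/-- Limits of the coefficients `b3`, `b2` and of the rescaled sixth and eighth order error
coefficients when the phase-lag and its first derivative vanish. -/
theorem tendsto_error_coefficients {δ : ℝ} (hδ : 0 < δ) {b0 b1 b2 b3 : ℝ → ℝ}
    (hcond : ∀ v : ℝ, 0 < |v| → |v| < δ →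
      N v (b0 v) (b1 v) (b2 v) (b3 v) = 0 ∧
      deriv (fun w => N w (b0 v) (b1 v) (b2 v) (b3 v)) v = 0 ∧
      b0 v = -95 / 6 + 16 * b3 v + 6 * b2 v ∧
      b1 v = 125 / 12 - 9 * b3 v - 4 * b2 v) :
    Tendsto b3 (𝓝[≠] 0) (𝓝 (17671 / 12096)) ∧
    Tendsto b2 (𝓝[≠] 0) (𝓝 (-3937 / 2016)) ∧
    Tendsto (fun v => (109 / 16 - 6 * b3 v - b2 v) / v ^ 4) (𝓝[≠] 0) (𝓝 (45767 / 725760)) ∧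
    Tendsto (fun v => (31405 / 12096 - 2 * b3 v - b2 v / 6) / v ^ 2) (𝓝[≠] 0)
      (𝓝 (2 * (45767 / 725760))) := by
  obtain ⟨C, hC, hcos⟩ := exists_cos_taylor_ten
  obtain ⟨D, hD, hcos'⟩ := exists_cos_taylor_eight
  obtain ⟨S, hS, hsin⟩ := exists_sin_taylor_nine
  obtain ⟨R, hR, hsin'⟩ := exists_sin_taylor_seven
  have hscale {r : ℝ → ℝ} (hr : Tendsto r (𝓝[≠] 0) (𝓝 0)) {c : ℝ} (hc : c ≠ 0) :
      Tendsto (fun v => r (c * v)) (𝓝[≠] 0) (𝓝 0) :=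
    hr.comp (tendsto_const_mul_punctured_nhds_zero hc)
  have hid : Tendsto (fun v : ℝ => v) (𝓝[≠] 0) (𝓝 0) :=
    tendsto_id.mono_left nhdsWithin_le_nhds
  set E₀ : ℝ → ℝ := fun v => 2 * 4 ^ 10 * C (4 * v) - 4 * 3 ^ 10 * C (3 * v)
    + 4 * 2 ^ 10 * C (2 * v) - 2 * C v + 125 / 6 * D v with hE₀
  set E₃ : ℝ → ℝ := fun v => 2 * 3 ^ 8 * D (3 * v) - 18 * D v with hE₃
  set E₂ : ℝ → ℝ := fun v => 2 * 2 ^ 8 * D (2 * v) - 8 * D v with hE₂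
  set F₀ : ℝ → ℝ := fun v => -8 * 4 ^ 9 * S (4 * v) + 12 * 3 ^ 9 * S (3 * v)
    - 8 * 2 ^ 9 * S (2 * v) + 2 * S v + 125 / 3 * D v - 125 / 6 * R v with hF₀
  set F₃ : ℝ → ℝ := fun v => 4 * 3 ^ 8 * D (3 * v) - 36 * D v
    - 6 * 3 ^ 7 * R (3 * v) + 18 * R v with hF₃
  set F₂ : ℝ → ℝ := fun v => 4 * 2 ^ 8 * D (2 * v) - 16 * D v
    - 4 * 2 ^ 7 * R (2 * v) + 8 * R v with hF₂
  have hE₀_lim : Tendsto E₀ (𝓝[≠] 0) (𝓝 0) := by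
    simpa using (((((hscale hC four_ne_zero).const_mul (2 * 4 ^ 10)).sub
      ((hscale hC three_ne_zero).const_mul (4 * 3 ^ 10))).add
      ((hscale hC two_ne_zero).const_mul (4 * 2 ^ 10))).sub (hC.const_mul 2)).add
      (hD.const_mul (125 / 6))
  have hE₃_lim : Tendsto E₃ (𝓝[≠] 0) (𝓝 0) := by
    simpa using ((hscale hD three_ne_zero).const_mul (2 * 3 ^ 8)).sub (hD.const_mul 18)
  have hE₂_lim : Tendsto E₂ (𝓝[≠] 0) (𝓝 0) := by
    simpa using ((hscale hD two_ne_zero).const_mul (2 * 2 ^ 8)).sub (hD.const_mul 8)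
  have hF₀_lim : Tendsto F₀ (𝓝[≠] 0) (𝓝 0) := by
    simpa using ((((((hscale hS four_ne_zero).const_mul (-8 * 4 ^ 9)).add
      ((hscale hS three_ne_zero).const_mul (12 * 3 ^ 9))).sub
      ((hscale hS two_ne_zero).const_mul (8 * 2 ^ 9))).add (hS.const_mul 2)).add
      (hD.const_mul (125 / 3))).sub (hR.const_mul (125 / 6))
  have hF₃_lim : Tendsto F₃ (𝓝[≠] 0) (𝓝 0) := by
    simpa using ((((hscale hD three_ne_zero).const_mul (4 * 3 ^ 8)).sub (hD.const_mul 36)).sub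
      ((hscale hR three_ne_zero).const_mul (6 * 3 ^ 7))).add (hR.const_mul 18)
  have hF₂_lim : Tendsto F₂ (𝓝[≠] 0) (𝓝 0) := by
    simpa using ((((hscale hD two_ne_zero).const_mul (4 * 2 ^ 8)).sub (hD.const_mul 16)).sub
      ((hscale hR two_ne_zero).const_mul (4 * 2 ^ 7))).add (hR.const_mul 8)
  set G₀ : ℝ → ℝ := fun v => 74527 / 145152 + 4 * E₀ v - F₀ v / 2 with hG₀
  set G₃ : ℝ → ℝ := fun v => -13 / 40 + 4 * E₃ v - F₃ v / 2 with hG₃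
  set G₂ : ℝ → ℝ := fun v => -1 / 80 + 4 * E₂ v - F₂ v / 2 with hG₂
  set H₀ : ℝ → ℝ := fun v => 2 * (74527 / 145152) + 3 * E₀ v - F₀ v / 2 with hH₀
  set H₃ : ℝ → ℝ := fun v => 2 * (-13 / 40) + 3 * E₃ v - F₃ v / 2 with hH₃
  set H₂ : ℝ → ℝ := fun v => 2 * (-1 / 80) + 3 * E₂ v - F₂ v / 2 with hH₂
  have hcomb {E F : ℝ → ℝ} (hE : Tendsto E (𝓝[≠] 0) (𝓝 0)) (hF : Tendsto F (𝓝[≠] 0) (𝓝 0))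
      (a k : ℝ) : Tendsto (fun v => a + k * E v - F v / 2) (𝓝[≠] 0) (𝓝 a) := by
    simpa using ((hE.const_mul k).const_add a).sub (hF.div_const 2)
  have hG₀_lim : Tendsto G₀ _ _ := hcomb hE₀_lim hF₀_lim (74527 / 145152) 4
  have hG₃_lim : Tendsto G₃ _ _ := hcomb hE₃_lim hF₃_lim (-13 / 40) 4
  have hG₂_lim : Tendsto G₂ _ _ := hcomb hE₂_lim hF₂_lim (-1 / 80) 4
  have hH₀_lim : Tendsto H₀ _ _ := hcomb hE₀_lim hF₀_lim (2 * (74527 / 145152)) 3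
  have hH₃_lim : Tendsto H₃ _ _ := hcomb hE₃_lim hF₃_lim (2 * (-13 / 40)) 3
  have hH₂_lim : Tendsto H₂ _ _ := hcomb hE₂_lim hF₂_lim (2 * (-1 / 80)) 3
  have hsmall : ∀ᶠ v : ℝ in 𝓝[≠] 0, v ≠ 0 ∧ |v| < δ := by
    refine eventually_mem_nhdsWithin.and (nhdsWithin_le_nhds ?_)
    filter_upwards [Metric.ball_mem_nhds (0 : ℝ) hδ] with v hv
    simpa using hv
  have hsystem : ∀ᶠ v : ℝ in 𝓝[≠] 0, v ≠ 0 ∧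
      109 / 16 - 6 * b3 v - b2 v = v ^ 4 * (G₀ v + G₃ v * b3 v + G₂ v * b2 v) ∧
      31405 / 12096 - 2 * b3 v - b2 v / 6 = v ^ 2 * (H₀ v + H₃ v * b3 v + H₂ v * b2 v) := by
    filter_upwards [hsmall] with v ⟨hv, hvδ⟩
    obtain ⟨hN, hN', h0, h1⟩ := hcond v (abs_pos.2 hv) hvδ
    have hv₂ : 2 * v ≠ 0 := mul_ne_zero two_ne_zero hv
    have hv₃ : 3 * v ≠ 0 := mul_ne_zero three_ne_zero hv
    have hv₄ : 4 * v ≠ 0 := mul_ne_zero four_ne_zero hv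
    have hN_expand : v ^ 6 * (-(109 / 16 - 6 * b3 v - b2 v)
        + v ^ 2 * (31405 / 12096 - 2 * b3 v - b2 v / 6)
        - v ^ 4 * (74527 / 145152 - 13 / 40 * b3 v - b2 v / 80)
        + v ^ 4 * (E₀ v + E₃ v * b3 v + E₂ v * b2 v)) = 0 := by
      rw [N_eq_cos_multiples, h0, h1] at hN
      simp only [hE₀, hE₃, hE₂]
      linear_combination hN - 2 * hcos _ hv₄ + 4 * hcos _ hv₃ - 4 * hcos _ hv₂ + 2 * hcos _ hv
        - v ^ 2 * (2 * b3 v * hcos' _ hv₃ + 2 * b2 v * hcos' _ hv₂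
          + 2 * (125 / 12 - 9 * b3 v - 4 * b2 v) * hcos' _ hv)
    have hN'_expand : v ^ 5 * (-6 * (109 / 16 - 6 * b3 v - b2 v)
        + 8 * v ^ 2 * (31405 / 12096 - 2 * b3 v - b2 v / 6)
        - 10 * v ^ 4 * (74527 / 145152 - 13 / 40 * b3 v - b2 v / 80)
        + v ^ 4 * (F₀ v + F₃ v * b3 v + F₂ v * b2 v)) = 0 := by
      rw [deriv_N, h0, h1] at hN'
      simp only [hF₀, hF₃, hF₂]
      linear_combination hN' + 8 * hsin _ hv₄ - 12 * hsin _ hv₃ + 8 * hsin _ hv₂ - 2 * hsin _ hv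
        - 2 * v * (2 * b3 v * hcos' _ hv₃ + 2 * b2 v * hcos' _ hv₂
          + 2 * (125 / 12 - 9 * b3 v - 4 * b2 v) * hcos' _ hv)
        + v ^ 2 * (6 * b3 v * hsin' _ hv₃ + 4 * b2 v * hsin' _ hv₂
          + 2 * (125 / 12 - 9 * b3 v - 4 * b2 v) * hsin' _ hv)
    have hE := (mul_eq_zero.1 hN_expand).resolve_left (pow_ne_zero 6 hv)
    have hF := (mul_eq_zero.1 hN'_expand).resolve_left (pow_ne_zero 5 hv)
    refine ⟨hv, ?_, mul_left_cancel₀ (pow_ne_zero 2 hv) ?_⟩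
    · simp only [hG₀, hG₃, hG₂]
      linear_combination hF / 2 - 4 * hE
    · simp only [hH₀, hH₃, hH₂]
      linear_combination hF / 2 - 3 * hE
  have hX_coeff {G H : ℝ → ℝ} {g k : ℝ} (hG : Tendsto G (𝓝[≠] 0) (𝓝 g))
      (hH : Tendsto H (𝓝[≠] 0) (𝓝 k)) (a c : ℝ) :
      Tendsto (fun v => a * (v ^ 4 * G v) + c * (v ^ 2 * H v)) (𝓝[≠] 0) (𝓝 0) := by
    simpa using (((hid.pow 4).mul hG).const_mul a).add (((hid.pow 2).mul hH).const_mul c)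
  obtain ⟨hb3, hb2⟩ := tendsto_of_perturbed_linear_system (X := b3) (Y := b2)
    (A := 17671 / 12096) (C := -3937 / 2016)
    (hX_coeff hG₀_lim hH₀_lim (1 / 6) (-1)) (hX_coeff hG₃_lim hH₃_lim (1 / 6) (-1))
    (hX_coeff hG₂_lim hH₂_lim (1 / 6) (-1)) (hX_coeff hG₀_lim hH₀_lim (-2) 6)
    (hX_coeff hG₃_lim hH₃_lim (-2) 6) (hX_coeff hG₂_lim hH₂_lim (-2) 6)
    (by
      filter_upwards [hsystem] with v ⟨_, h₁, h₂⟩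
      linear_combination h₁ / 6 - h₂)
    (by
      filter_upwards [hsystem] with v ⟨_, h₁, h₂⟩
      linear_combination -2 * h₁ + 6 * h₂)
  refine ⟨hb3, hb2, ?_, ?_⟩
  · have hlim := (hG₀_lim.add (hG₃_lim.mul hb3)).add (hG₂_lim.mul hb2)
    norm_num at hlim
    refine hlim.congr' ?_
    filter_upwards [hsystem] with v ⟨hv, h₁, _⟩
    rw [h₁, mul_div_cancel_left₀ _ (pow_ne_zero 4 hv)]
  · have hlim := (hH₀_lim.add (hH₃_lim.mul hb3)).add (hH₂_lim.mul hb2)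
    norm_num at hlim ⊢
    refine hlim.congr' ?_
    filter_upwards [hsystem] with v ⟨hv, _, h₂⟩
    rw [h₂, mul_div_cancel_left₀ _ (pow_ne_zero 2 hv)]

/-- The principal term of the local truncation error of the method with zero
phase-lag and zero first derivative of the phase-lag is
`(45767/725760) · h^10 · (y⁽¹⁰⁾ + 2ω² y⁽⁸⁾ + ω⁴ y⁽⁶⁾)`. -/
theorem zero_PL_PL'_method_principal_LTE
    (ω : ℝ) (hω : 0 < ω) (y : ℝ → ℝ) (hy : ContDiff ℝ (⊤ : ℕ∞) y) (x : ℝ)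
    (δ : ℝ) (hδ : 0 < δ) (b0 b1 b2 b3 : ℝ → ℝ)
    (hcond : ∀ v : ℝ, 0 < |v| → |v| < δ →
      N v (b0 v) (b1 v) (b2 v) (b3 v) = 0 ∧
      deriv (fun w => N w (b0 v) (b1 v) (b2 v) (b3 v)) v = 0 ∧
      b0 v = -95 / 6 + 16 * b3 v + 6 * b2 v ∧
      b1 v = 125 / 12 - 9 * b3 v - 4 * b2 v) :
    Filter.Tendsto
      (fun h : ℝ =>
        (y (x + 4 * h) + y (x - 4 * h)
          - 2 * (y (x + 3 * h) + y (x - 3 * h))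
          + 2 * (y (x + 2 * h) + y (x - 2 * h))
          - (y (x + h) + y (x - h))
          - h ^ 2 *
            (b3 (ω * h) * (iteratedDeriv 2 y (x + 3 * h) + iteratedDeriv 2 y (x - 3 * h))
              + b2 (ω * h) * (iteratedDeriv 2 y (x + 2 * h) + iteratedDeriv 2 y (x - 2 * h))
              + b1 (ω * h) * (iteratedDeriv 2 y (x + h) + iteratedDeriv 2 y (x - h))
              + b0 (ω * h) * iteratedDeriv 2 y x)) / h ^ 10)
      (nhdsWithin 0 {(0 : ℝ)}ᶜ)
      (nhds ((45767 / 725760) *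
        (iteratedDeriv 10 y x + 2 * ω ^ 2 * iteratedDeriv 8 y x
          + ω ^ 4 * iteratedDeriv 6 y x))) := by
  obtain ⟨hb3, hb2, hT₆, hT₈⟩ := tendsto_error_coefficients hδ hcond
  have hωlim := tendsto_const_mul_punctured_nhds_zero hω.ne'
  have hb3ω := hb3.comp hωlim
  have hb2ω := hb2.comp hωlim
  have hy₁₀ : ContDiff ℝ 10 y := contDiff_infty.1 hy 10
  have hy'' : ContDiff ℝ 8 (iteratedDeriv 2 y) := by
    rw [iteratedDeriv_eq_iterate]
    exact ContDiff.iterate_deriv' 8 2 hy₁₀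
  obtain ⟨r, hr, hyr⟩ := ContDiff.exists_symmetric_taylor_ten hy₁₀ x
  obtain ⟨s, hs, hys⟩ := ContDiff.exists_symmetric_taylor_eight hy'' x
  have hderiv (k : ℕ) : iteratedDeriv k (iteratedDeriv 2 y) x = iteratedDeriv (k + 2) y x := by
    simp only [iteratedDeriv_eq_iterate, Function.iterate_add_apply]
  simp only [hderiv, Nat.reduceAdd] at hys
  have hscale {u : ℝ → ℝ} (hu : Tendsto u (𝓝[≠] 0) (𝓝 0)) {c : ℝ} (hc : c ≠ 0) :
      Tendsto (fun h => u (c * h)) (𝓝[≠] 0) (𝓝 0) :=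
    hu.comp (tendsto_const_mul_punctured_nhds_zero hc)
  have hmain := (((hT₆.comp hωlim).const_mul (ω ^ 4 * iteratedDeriv 6 y x)).add
    ((hT₈.comp hωlim).const_mul (ω ^ 2 * iteratedDeriv 8 y x))).add
    ((((hb3ω.const_mul (-13 / 40)).add (hb2ω.const_mul (-1 / 80))).const_add
      (74527 / 145152)).const_mul (iteratedDeriv 10 y x))
  have hrem_y := ((((hscale hr four_ne_zero).const_mul (4 ^ 10)).sub
    ((hscale hr three_ne_zero).const_mul (2 * 3 ^ 10))).add
    ((hscale hr two_ne_zero).const_mul (2 * 2 ^ 10))).sub hr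
  have hrem_y'' := ((hb3ω.mul ((hscale hs three_ne_zero).const_mul (3 ^ 8))).add
    (hb2ω.mul ((hscale hs two_ne_zero).const_mul (2 ^ 8)))).add
    ((((hb3ω.const_mul 9).const_sub (125 / 12)).sub (hb2ω.const_mul 4)).mul hs)
  have hlim := (hmain.add hrem_y).sub hrem_y''
  have hsmall : ∀ᶠ h : ℝ in 𝓝[≠] 0, h ≠ 0 ∧ |ω * h| < δ := by
    refine eventually_mem_nhdsWithin.and ?_
    have := (hωlim.mono_right nhdsWithin_le_nhds).eventually (Metric.ball_mem_nhds (0 : ℝ) hδ)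
    filter_upwards [this] with h hh
    simpa using hh
  refine (hlim.congr' ?_).mono_right (le_of_eq (congrArg nhds (by ring)))
  filter_upwards [hsmall] with h ⟨hh, hhδ⟩
  obtain ⟨_, _, h0, h1⟩ := hcond (ω * h) (abs_pos.2 (mul_ne_zero hω.ne' hh)) hhδ
  rw [hyr _ hh, hyr _ (mul_ne_zero two_ne_zero hh), hyr _ (mul_ne_zero three_ne_zero hh),
    hyr _ (mul_ne_zero four_ne_zero hh), hys _ hh, hys _ (mul_ne_zero two_ne_zero hh),
    hys _ (mul_ne_zero three_ne_zero hh), h0, h1]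
  simp only [Function.comp_apply]
  have hω' := hω.ne'
  field_simp
  ring
end
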